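/- Let k ≥ 1, n ≥ 1, and let ξ be a rotationally invariant random vector in ℝⁿ with E[‖ξ‖^{2k}] < ∞, where ‖·‖ is the Euclidean norm. Then for every map i : {1,…,2k} → {1,…,n}: E[∏_{a=1}^{2k} ξ_{i(a)}] = (E[‖ξ‖^{2k}] / ∏_{j=0}^{k−1}(n+2j)) · Σ_f ∏_{a=1}^{2k} δ_{i(a), i(f(a))}, where the sum runs over all fixed-point-free involutions f of {1,…,2k} (equivalently, over all pair partitions of {1,…,2k}, the product of Kronecker deltas being the indicator that i is constant on each pair of the matching). -/

import Mathlib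

open MeasureTheory Matrix

theorem aux_tensor {m n : ℕ} (F : (Fin m → Fin n) → ℝ)
    (hsym : ∀ (σ : Equiv.Perm (Fin m)) i, F (i ∘ σ) = F i)
    (h0 : ∀ u : Fin n → ℝ, ∑ i, F i * ∏ a, u (i a) = 0) : ∀ i, F i = 0 := by
  classical
  intro i0
  let d : (Fin m → Fin n) → (Fin n →₀ ℕ) := fun i => ∑ a, Finsupp.single (i a) 1
  have hP : (∑ i, MvPolynomial.monomial (d i) (F i) : MvPolynomial (Fin n) ℝ) = 0 := by
    apply MvPolynomial.funext
    intro u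
    rw [map_sum, map_zero, ← h0 u]
    refine Finset.sum_congr rfl fun i _ => ?_
    have : MvPolynomial.monomial (d i) (F i) =
        MvPolynomial.C (F i) * ∏ a, MvPolynomial.X (i a) := by
      simp only [MvPolynomial.X, d]
      rw [MvPolynomial.monomial_sum_index]
    rw [this]
    simp
  have hc := congrArg (MvPolynomial.coeff (d i0)) hP
  simp only [MvPolynomial.coeff_sum, MvPolynomial.coeff_monomial, MvPolynomial.coeff_zero] at hc
  have key : ∀ i, d i = d i0 → F i = F i0 := by
    intro i hi
    have hcard : ∀ j, Fintype.card {a // i a = j} = Fintype.card {a // i0 a = j} := by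
      intro j
      have := DFunLike.congr_fun hi j
      simpa [d, Finsupp.finsetSum_apply, Finsupp.single_apply, Fintype.card_subtype] using this
    let e : ∀ j, {a // i a = j} ≃ {a // i0 a = j} := fun j => Fintype.equivOfCardEq (hcard j)
    let σ : Equiv.Perm (Fin m) := ((Equiv.sigmaFiberEquiv i).symm.trans
      (Equiv.sigmaCongrRight e)).trans (Equiv.sigmaFiberEquiv i0)
    have : i0 ∘ σ = i := by
      funext a
      exact (e (i a) ⟨a, rfl⟩).2
    rw [← this, hsym]
  have h2 : ∑ i, (if d i = d i0 then F i else 0) = ∑ i, (if d i = d i0 then (1:ℝ) else 0) * F i0 := by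
    refine Finset.sum_congr rfl fun i _ => ?_
    split_ifs with h
    · rw [key i h, one_mul]
    · simp
  rw [h2, ← Finset.sum_mul] at hc
  refine (mul_eq_zero.mp hc).resolve_left (ne_of_gt ?_)
  refine Finset.sum_pos' (fun i _ => by split_ifs <;> norm_num) ⟨i0, Finset.mem_univ _, by simp⟩

theorem aux_cycleType {k : ℕ} (f : Equiv.Perm (Fin (2 * k))) :
    ((∀ a, f (f a) = a) ∧ ∀ a, f a ≠ a) ↔ f.cycleType = Multiset.replicate k 2 := by
  constructor
  · rintro ⟨h1, h2⟩
    have hp : f ^ 2 = 1 := by ext a; simp [pow_two, h1]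
    have hs : f.support = Finset.univ := by ext a; simp [h2]
    have := Equiv.Perm.cycleType_of_pow_prime_eq_one (p := 2) hp
    have h3 := f.sum_cycleType
    rw [this] at h3 ⊢
    rw [hs] at h3
    simp at h3
    congr 1
    omega
  · intro h
    have h3 := f.sum_cycleType
    rw [h] at h3
    simp at h3
    have hs : f.support = Finset.univ := by
      rw [← Finset.card_eq_iff_eq_univ, ← h3]; simp [mul_comm]
    have hp : f ^ 2 = 1 := by
      rw [← orderOf_dvd_iff_pow_eq_one, ← Equiv.Perm.lcm_cycleType, h]
      apply Multiset.lcm_dvd.mpr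
      intro b hb
      rw [Multiset.eq_of_mem_replicate hb]
    constructor
    · intro a
      have := DFunLike.congr_fun hp a
      simpa [pow_two] using this
    · intro a
      have : a ∈ f.support := by simp [hs]
      simpa using this

theorem aux_count (k : ℕ) (hk : 1 ≤ k) :
    (Fintype.card {f : Equiv.Perm (Fin (2 * k)) // (∀ a, f (f a) = a) ∧ ∀ a, f a ≠ a} : ℝ)
      = ∏ j ∈ Finset.range k, (2 * (j : ℝ) + 1) := by
  have h := Equiv.Perm.card_of_cycleType (Fin (2 * k)) (Multiset.replicate k 2)
  have h2 : ∀ a ∈ Multiset.replicate k 2, 2 ≤ a := fun a ha =>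
    (Multiset.eq_of_mem_replicate ha).ge
  rw [Fintype.card_subtype, Finset.filter_congr (fun f _ => aux_cycleType f), h,
    if_pos ⟨by simp [mul_comm], h2⟩]
  have ht : (Multiset.replicate k 2).toFinset = {2} := by
    rw [Multiset.toFinset_replicate, if_neg (by omega)]
  rw [ht]
  simp only [Fintype.card_fin, Multiset.sum_replicate, Multiset.prod_replicate, smul_eq_mul,
    Finset.prod_singleton, Multiset.count_replicate_self]
  rw [mul_comm k 2, Nat.sub_self, Nat.factorial_zero, one_mul]
  have hf : ∀ k : ℕ, (2 * k).factorial = (2 ^ k * k.factorial) * ∏ j ∈ Finset.range k, (2 * j + 1) := by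
    intro k
    induction k with
    | zero => simp
    | succ k ih =>
      rw [Finset.prod_range_succ, show 2 * (k + 1) = 2 * k + 1 + 1 by ring, Nat.factorial_succ,
        Nat.factorial_succ, ih, Nat.factorial_succ]
      ring
  rw [hf, Nat.mul_div_cancel_left _ (by positivity)]
  push_cast
  rfl

theorem aux_flip (k : ℕ) (f : Equiv.Perm (Fin (2 * k)))
    (hf : (∀ a, f (f a) = a) ∧ ∀ a, f a ≠ a) :
    ∃ e : Fin k × Bool ≃ Fin (2 * k), ∀ x b, f (e (x, b)) = e (x, !b) := by
  have e0 : Fin k × Bool ≃ Fin (2 * k) := Fintype.equivOfCardEq (by simp [mul_comm])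
  let s : Equiv.Perm (Fin k × Bool) := Equiv.prodCongr (Equiv.refl _) Equiv.boolNot
  let g : Equiv.Perm (Fin (2 * k)) := (e0.symm.trans s).trans e0
  have hg : (∀ a, g (g a) = a) ∧ ∀ a, g a ≠ a := by
    constructor
    · intro a
      obtain ⟨p, rfl⟩ := e0.surjective a
      obtain ⟨x, b⟩ := p
      simp [g, s]
    · intro a
      obtain ⟨p, rfl⟩ := e0.surjective a
      simp [g, s, Prod.ext_iff]
  have hc : IsConj g f := by
    rw [Equiv.Perm.isConj_iff_cycleType_eq, (aux_cycleType g).1 hg, (aux_cycleType f).1 hf]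
  obtain ⟨c, hc⟩ := isConj_iff.1 hc
  refine ⟨e0.trans c, fun x b => ?_⟩
  rw [← hc]
  simp [g, s]

theorem aux_pair {n : ℕ} (k : ℕ) (f : Equiv.Perm (Fin (2 * k)))
    (hf : (∀ a, f (f a) = a) ∧ ∀ a, f a ≠ a) (u : Fin n → ℝ) :
    ∑ i : Fin (2 * k) → Fin n, (∏ a, (if i a = i (f a) then (1 : ℝ) else 0)) * ∏ a, u (i a)
      = (∑ j, u j ^ 2) ^ k := by
  obtain ⟨e, he⟩ := aux_flip k f hf
  let g : (Bool → Fin n) → ℝ := fun h => ∏ b, ((if h b = h (!b) then (1 : ℝ) else 0) * u (h b))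
  have h1 : ∑ h, g h = ∑ j, u j ^ 2 := by
    rw [← (Equiv.boolArrowEquivProd (Fin n)).symm.sum_comp, Fintype.sum_prod_type]
    refine Finset.sum_congr rfl fun j _ => ?_
    rw [Finset.sum_eq_single j]
    · simp [g, pow_two]
    · intro b _ hb
      simp [g, hb]
    · simp
  rw [← h1, Fintype.sum_pow]
  let E : (Fin k → Bool → Fin n) ≃ (Fin (2 * k) → Fin n) :=
    (Equiv.curry _ _ _).symm.trans (Equiv.arrowCongr e (Equiv.refl _))
  rw [← E.sum_comp]
  refine Finset.sum_congr rfl fun i _ => ?_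
  rw [← Finset.prod_mul_distrib, ← e.prod_comp, Fintype.prod_prod_type]
  refine Finset.prod_congr rfl fun x _ => Finset.prod_congr rfl fun b _ => ?_
  rw [he]
  simp [E]

theorem aux_sumpair {n : ℕ} (k : ℕ) (hk : 1 ≤ k) (u : Fin n → ℝ) :
    ∑ i : Fin (2 * k) → Fin n,
      (∑ f : {f : Equiv.Perm (Fin (2 * k)) // (∀ a, f (f a) = a) ∧ ∀ a, f a ≠ a},
        ∏ a, (if i a = i (f.1 a) then (1 : ℝ) else 0)) * ∏ a, u (i a)
      = (∏ j ∈ Finset.range k, (2 * (j : ℝ) + 1)) * (∑ j, u j ^ 2) ^ k := by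
  simp_rw [Finset.sum_mul]
  rw [Finset.sum_comm, Finset.sum_congr rfl (fun f _ => aux_pair k f.1 f.2 u), ← aux_count k hk]
  simp

theorem aux_symQ {n : ℕ} (k : ℕ) (σ : Equiv.Perm (Fin (2 * k))) (i : Fin (2 * k) → Fin n) :
    (∑ f : {f : Equiv.Perm (Fin (2 * k)) // (∀ a, f (f a) = a) ∧ ∀ a, f a ≠ a},
        ∏ a, (if (i ∘ σ) a = (i ∘ σ) (f.1 a) then (1 : ℝ) else 0)) =
    (∑ f : {f : Equiv.Perm (Fin (2 * k)) // (∀ a, f (f a) = a) ∧ ∀ a, f a ≠ a},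
        ∏ a, (if i a = i (f.1 a) then (1 : ℝ) else 0)) := by
  let E : {f : Equiv.Perm (Fin (2 * k)) // (∀ a, f (f a) = a) ∧ ∀ a, f a ≠ a} ≃
      {f : Equiv.Perm (Fin (2 * k)) // (∀ a, f (f a) = a) ∧ ∀ a, f a ≠ a} :=
    (MulAut.conj σ).toEquiv.subtypeEquiv (fun f => by
      rw [aux_cycleType, aux_cycleType]
      simp [Equiv.Perm.cycleType_conj])
  symm
  rw [← E.sum_comp]
  refine Finset.sum_congr rfl fun f _ => ?_
  rw [← Equiv.prod_comp σ (fun a => if i a = i ((E f).1 a) then (1 : ℝ) else 0)]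
  refine Finset.prod_congr rfl fun a _ => ?_
  simp [E]

/-- Householder -/
theorem aux_house {n : ℕ} (u v : Fin n → ℝ) (h : ∑ j, u j ^ 2 = ∑ j, v j ^ 2) :
    ∃ O : Matrix (Fin n) (Fin n) ℝ, Oᵀ * O = 1 ∧ u ᵥ* O = v := by
  by_cases huv : u = v
  · exact ⟨1, by simp, by simp [huv]⟩
  let w := u - v
  have hw : w ⬝ᵥ w ≠ 0 := by
    rw [Ne, dotProduct_self_eq_zero, sub_eq_zero]; exact huv
  have h' : u ⬝ᵥ u = v ⬝ᵥ v := by simpa [dotProduct, pow_two] using h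
  have hT : (1 - (2 / (w ⬝ᵥ w)) • vecMulVec w w)ᵀ = 1 - (2 / (w ⬝ᵥ w)) • vecMulVec w w := by
    simp [transpose_vecMulVec]
  refine ⟨1 - (2 / (w ⬝ᵥ w)) • vecMulVec w w, ?_, ?_⟩
  · rw [hT]
    have hsq : vecMulVec w w * vecMulVec w w = (w ⬝ᵥ w) • vecMulVec w w := by
      rw [vecMulVec_mul_vecMulVec]; ext a b; simp [vecMulVec_apply]; ring
    simp only [sub_mul, mul_sub, one_mul, mul_one, smul_mul_assoc, mul_smul_comm, hsq, smul_smul]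
    ext a b
    simp only [Matrix.sub_apply, Matrix.smul_apply, smul_eq_mul]
    field_simp
    ring
  · have h2 : w ⬝ᵥ w = 2 * (u ⬝ᵥ w) := by
      have hc := dotProduct_comm u v
      simp only [w, dotProduct_sub, sub_dotProduct]; linarith
    have h3 : u ⬝ᵥ w ≠ 0 := fun h0 => hw (by rw [h2, h0, mul_zero])
    rw [vecMul_sub, vecMul_one, vecMul_smul, vecMul_vecMulVec, smul_smul, h2]
    have : 2 / (2 * (u ⬝ᵥ w)) * (u ⬝ᵥ w) = 1 := by field_simp
    rw [this]; simp [w]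

theorem aux_inv {n : ℕ} (ν : Measure (Fin n → ℝ))
    (hrot : ∀ O : Matrix (Fin n) (Fin n) ℝ, Oᵀ * O = 1 → ν.map (fun x => O *ᵥ x) = ν)
    (j r : ℕ) (u v : Fin n → ℝ) (h : ∑ j, u j ^ 2 = ∑ j, v j ^ 2) :
    ∫ x, (u ⬝ᵥ x) ^ j * (∑ l, x l ^ 2) ^ r ∂ν = ∫ x, (v ⬝ᵥ x) ^ j * (∑ l, x l ^ 2) ^ r ∂ν := by
  obtain ⟨O, hO, huv⟩ := aux_house u v h
  conv_lhs => rw [← hrot O hO]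
  rw [integral_map]
  · congr 1
    funext x
    have : ∑ l, (O *ᵥ x) l ^ 2 = ∑ l, x l ^ 2 := by
      have h1 : (O *ᵥ x) ⬝ᵥ (O *ᵥ x) = x ⬝ᵥ x := by
        rw [dotProduct_mulVec, ← mulVec_transpose, mulVec_mulVec, hO, one_mulVec]
      simpa [dotProduct, pow_two] using h1
    rw [this, dotProduct_mulVec, huv]
  · fun_prop
  · refine Continuous.aestronglyMeasurable ?_
    unfold dotProduct
    fun_prop

theorem aux_integrable {n : ℕ} (ν : Measure (Fin n → ℝ)) (k : ℕ)
    (hmom : Integrable (fun x : Fin n → ℝ => (∑ i, x i ^ 2) ^ k) ν)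
    (g : (Fin n → ℝ) → ℝ) (hg : Continuous g)
    (hb : ∀ x, |g x| ≤ (∑ i, x i ^ 2) ^ k) : Integrable g ν := by
  refine hmom.mono' hg.aestronglyMeasurable (ae_of_all _ hb)

theorem aux_coord {n : ℕ} (x : Fin n → ℝ) (i : Fin n) : |x i| ≤ √(∑ l, x l ^ 2) := by
  apply Real.abs_le_sqrt
  exact Finset.single_le_sum (f := fun l => x l ^ 2) (fun l _ => sq_nonneg _) (Finset.mem_univ i)

theorem aux_integrable2 {n : ℕ} (ν : Measure (Fin n → ℝ)) (k : ℕ)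
    (hmom : Integrable (fun x : Fin n → ℝ => (∑ i, x i ^ 2) ^ k) ν)
    (p q r : ℕ) (hpq : p + q + 2 * r = 2 * k) (a b : Fin n) :
    Integrable (fun x : Fin n → ℝ => x a ^ p * x b ^ q * (∑ i, x i ^ 2) ^ r) ν := by
  refine aux_integrable ν k hmom _ (by fun_prop) fun x => ?_
  have hS : 0 ≤ ∑ i, x i ^ 2 := Finset.sum_nonneg fun l _ => sq_nonneg _
  have e : ∀ r, (∑ i, x i ^ 2) ^ r = √(∑ i, x i ^ 2) ^ (2 * r) := fun r => by
    rw [pow_mul, Real.sq_sqrt hS]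
  rw [abs_mul, abs_mul, abs_pow, abs_pow, abs_of_nonneg (pow_nonneg hS r), e, e, ← hpq, pow_add,
    pow_add]
  gcongr
  · exact aux_coord x a
  · exact aux_coord x b

theorem aux_integrable3 {n : ℕ} (ν : Measure (Fin n → ℝ)) (k : ℕ)
    (hmom : Integrable (fun x : Fin n → ℝ => (∑ i, x i ^ 2) ^ k) ν)
    (i : Fin (2 * k) → Fin n) :
    Integrable (fun x : Fin n → ℝ => ∏ a, x (i a)) ν := by
  refine aux_integrable ν k hmom _ (by fun_prop) fun x => ?_
  have hS : 0 ≤ ∑ i, x i ^ 2 := Finset.sum_nonneg fun l _ => sq_nonneg _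
  rw [Finset.abs_prod]
  calc ∏ a, |x (i a)| ≤ ∏ a : Fin (2 * k), √(∑ l, x l ^ 2) :=
        Finset.prod_le_prod (fun _ _ => abs_nonneg _) (fun a _ => aux_coord x (i a))
    _ = _ := by simp [pow_mul, Real.sq_sqrt hS]

theorem aux_const {n : ℕ} (ν : Measure (Fin n → ℝ))
    (hrot : ∀ O : Matrix (Fin n) (Fin n) ℝ, Oᵀ * O = 1 → ν.map (fun x => O *ᵥ x) = ν)
    (j r : ℕ) (z : Fin n) (u : Fin n → ℝ) :
    ∫ x, (u ⬝ᵥ x) ^ (2 * j) * (∑ l, x l ^ 2) ^ r ∂ν =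
      (∑ l, u l ^ 2) ^ j * ∫ x, x z ^ (2 * j) * (∑ l, x l ^ 2) ^ r ∂ν := by
  have hS : 0 ≤ ∑ i, u i ^ 2 := Finset.sum_nonneg fun l _ => sq_nonneg _
  have hs : ∑ l, u l ^ 2 = ∑ l, (Pi.single z (√(∑ l, u l ^ 2)) : Fin n → ℝ) l ^ 2 := by
    rw [Finset.sum_eq_single (f := fun l => (Pi.single z (√(∑ l, u l ^ 2)) : Fin n → ℝ) l ^ 2) z]
    · simp [Real.sq_sqrt hS]
    · intro b _ hb; simp [hb]
    · simp
  rw [aux_inv ν hrot (2 * j) r u (Pi.single z (√(∑ l, u l ^ 2))) hs, ← integral_const_mul]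
  simp only [single_dotProduct, mul_pow, pow_mul, Real.sq_sqrt hS, mul_assoc]

theorem aux_second {n : ℕ} (ν : Measure (Fin n → ℝ)) (k : ℕ)
    (hrot : ∀ O : Matrix (Fin n) (Fin n) ℝ, Oᵀ * O = 1 → ν.map (fun x => O *ᵥ x) = ν)
    (hmom : Integrable (fun x : Fin n → ℝ => (∑ i, x i ^ 2) ^ k) ν)
    (j r : ℕ) (hjr : j + 1 + r = k) (z l : Fin n) (hl : l ≠ z) :
    (2 * j + 1) * ∫ x, x z ^ (2 * j) * x l ^ 2 * (∑ l, x l ^ 2) ^ r ∂ν =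
      ∫ x, x z ^ (2 * (j + 1)) * (∑ l, x l ^ 2) ^ r ∂ν := by
  set c := ∫ x, x z ^ (2 * (j + 1)) * (∑ l, x l ^ 2) ^ r ∂ν with hc
  let d : ℕ → ℝ := fun m => ∫ x, x l ^ m * x z ^ (2 * (j + 1) - m) * (∑ l, x l ^ 2) ^ r ∂ν
  have hP : (∑ m ∈ Finset.range (2 * (j + 1) + 1),
      Polynomial.monomial m (((2 * (j + 1)).choose m : ℝ) * d m)) =
      Polynomial.C c * Polynomial.expand ℝ 2 ((1 + Polynomial.X) ^ (j + 1)) := by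
    apply Polynomial.funext
    intro t
    have h := aux_const ν hrot (j + 1) r z (Pi.single z 1 + Pi.single l t)
    have hs : ∑ a, (Pi.single z 1 + Pi.single l t : Fin n → ℝ) a ^ 2 = 1 + t ^ 2 := by
      have : ∀ a, (Pi.single z 1 + Pi.single l t : Fin n → ℝ) a ^ 2 =
          (if a = z then 1 else 0) + (if a = l then t ^ 2 else 0) := by
        intro a
        simp only [Pi.add_apply, Pi.single_apply]
        by_cases h1 : a = z
        · subst h1; simp [Ne.symm hl]
        · by_cases h2 : a = l <;> simp [h1, h2, hl]
      rw [Finset.sum_congr rfl (fun a _ => this a)]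
      simp [Finset.sum_add_distrib]
    rw [hs, ← hc] at h
    simp only [Polynomial.eval_mul, Polynomial.eval_C, Polynomial.expand_eval,
      Polynomial.eval_pow, Polynomial.eval_add, Polynomial.eval_one, Polynomial.eval_X]
    rw [mul_comm c, ← h]
    simp only [Polynomial.eval_finsetSum, Polynomial.eval_monomial, add_dotProduct,
      single_dotProduct, one_mul]
    have h5 : ∀ x : Fin n → ℝ, (x z + t * x l) ^ (2 * (j + 1)) * (∑ l, x l ^ 2) ^ r =
      ∑ m ∈ Finset.range (2 * (j + 1) + 1), (((2 * (j + 1)).choose m : ℝ) * t ^ m) *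
        (x l ^ m * x z ^ (2 * (j + 1) - m) * (∑ l, x l ^ 2) ^ r) := by
      intro x
      rw [add_comm, add_pow, Finset.sum_mul]
      refine Finset.sum_congr rfl fun m _ => ?_
      rw [mul_pow]; ring
    simp only [h5]
    rw [integral_finsetSum]
    · refine Finset.sum_congr rfl fun m _ => ?_
      rw [integral_const_mul]; ring
    · intro m hm
      rw [Finset.mem_range] at hm
      exact (aux_integrable2 ν k hmom _ _ _ (by omega) _ _).const_mul _
  have h2 := congrArg (fun P => Polynomial.coeff P 2) hP
  simp only [Polynomial.finsetSum_coeff, Polynomial.coeff_monomial, Polynomial.coeff_C_mul] at h2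
  rw [show (2 : ℕ) = 1 * 2 from rfl, Polynomial.coeff_expand_mul (by norm_num),
    Polynomial.coeff_one_add_X_pow] at h2
  simp only [one_mul] at h2
  rw [Finset.sum_ite_eq', if_pos (by simp), Nat.choose_one_right, Nat.cast_choose_two] at h2
  have hd : d 2 = ∫ x, x z ^ (2 * j) * x l ^ 2 * (∑ l, x l ^ 2) ^ r ∂ν := by
    simp only [d]
    congr 1; funext x
    rw [show 2 * (j + 1) - 2 = 2 * j by omega]; ring
  rw [← hd]
  push_cast at h2
  have hj : (j : ℝ) + 1 ≠ 0 := by positivity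
  apply mul_left_cancel₀ hj
  linear_combination h2

theorem aux_rec {n : ℕ} (ν : Measure (Fin n → ℝ)) (k : ℕ)
    (hrot : ∀ O : Matrix (Fin n) (Fin n) ℝ, Oᵀ * O = 1 → ν.map (fun x => O *ᵥ x) = ν)
    (hmom : Integrable (fun x : Fin n → ℝ => (∑ i, x i ^ 2) ^ k) ν)
    (j r : ℕ) (hjr : j + 1 + r = k) (z : Fin n) :
    (2 * j + 1) * ∫ x, x z ^ (2 * j) * (∑ l, x l ^ 2) ^ (r + 1) ∂ν =
      (n + 2 * j) * ∫ x, x z ^ (2 * (j + 1)) * (∑ l, x l ^ 2) ^ r ∂ν := by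
  set c := ∫ x, x z ^ (2 * (j + 1)) * (∑ l, x l ^ 2) ^ r ∂ν with hc
  have h1 : ∫ x, x z ^ (2 * j) * (∑ l, x l ^ 2) ^ (r + 1) ∂ν =
      ∑ l, ∫ x, x z ^ (2 * j) * x l ^ 2 * (∑ l, x l ^ 2) ^ r ∂ν := by
    rw [← integral_finsetSum]
    · congr 1; funext x
      rw [← Finset.sum_mul, ← Finset.mul_sum]; ring
    · intro l _
      exact aux_integrable2 ν k hmom _ _ _ (by omega) _ _
  rw [h1, Finset.mul_sum, ← Finset.add_sum_erase _ _ (Finset.mem_univ z),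
    Finset.sum_congr rfl (fun l hl => aux_second ν k hrot hmom j r hjr z l (Finset.ne_of_mem_erase hl)),
    ← hc]
  have : ∫ x, x z ^ (2 * j) * x z ^ 2 * (∑ l, x l ^ 2) ^ r ∂ν = c := by
    rw [hc]; congr 1; funext x; ring
  rw [this]
  have hn : 1 ≤ n := Nat.one_le_of_lt z.2
  simp only [Finset.sum_const, Finset.card_erase_of_mem (Finset.mem_univ z), Finset.card_univ, Fintype.card_fin, nsmul_eq_mul]
  push_cast [hn]
  ring

theorem aux_norm {n : ℕ} (ν : Measure (Fin n → ℝ)) (k : ℕ)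
    (hrot : ∀ O : Matrix (Fin n) (Fin n) ℝ, Oᵀ * O = 1 → ν.map (fun x => O *ᵥ x) = ν)
    (hmom : Integrable (fun x : Fin n → ℝ => (∑ i, x i ^ 2) ^ k) ν) (z : Fin n) (j : ℕ) :
    ∀ r, j + r = k →
    (∏ m ∈ Finset.range j, (2 * (m : ℝ) + 1)) * ∫ x, (∑ l, x l ^ 2) ^ k ∂ν =
      (∏ m ∈ Finset.range j, ((n : ℝ) + 2 * m)) *
        ∫ x, x z ^ (2 * j) * (∑ l, x l ^ 2) ^ r ∂ν := by
  induction j with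
  | zero => intro r hr; obtain rfl : r = k := by omega
            simp
  | succ j ih =>
    intro r hr
    have h1 := ih (r + 1) (by omega)
    have h2 := aux_rec ν k hrot hmom j r hr z
    rw [Finset.prod_range_succ, Finset.prod_range_succ]
    linear_combination (2 * (j : ℝ) + 1) * h1 + (∏ m ∈ Finset.range j, ((n : ℝ) + 2 * m)) * h2

/-- For a rotationally invariant random vector `ξ` in `ℝⁿ` with finite `2k`-th moment of the
Euclidean norm, the joint `2k`-th moments of the coordinates are
`E[∏ ξ_{i(a)}] = (E[‖ξ‖^{2k}] / ∏_{j=0}^{k-1}(n+2j)) · Σ_f ∏_a δ_{i(a), i(f(a))}`,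
the sum running over all fixed-point-free involutions `f` of `{1,…,2k}`
(equivalently, pair partitions of `{1,…,2k}`). -/
theorem stmt_2 {Ω : Type*} [MeasurableSpace Ω] (μ : Measure Ω) [IsProbabilityMeasure μ]
    (k n : ℕ) (hk : 1 ≤ k) (hn : 1 ≤ n)
    (ξ : Ω → Fin n → ℝ) (hmeas : Measurable ξ)
    (hrot : ∀ O : Matrix (Fin n) (Fin n) ℝ, Oᵀ * O = 1 →
      Measure.map (fun ω => O.mulVec (ξ ω)) μ = Measure.map ξ μ)
    (hmom : Integrable (fun ω => (∑ i, ξ ω i ^ 2) ^ k) μ) :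
    ∀ i : Fin (2 * k) → Fin n,
      ∫ ω, ∏ a, ξ ω (i a) ∂μ =
        (∫ ω, (∑ j, ξ ω j ^ 2) ^ k ∂μ) / (∏ j ∈ Finset.range k, ((n : ℝ) + 2 * (j : ℝ))) *
          ∑ f : {f : Equiv.Perm (Fin (2 * k)) // (∀ a, f (f a) = a) ∧ ∀ a, f a ≠ a},
            ∏ a, (if i a = i (f.1 a) then (1 : ℝ) else 0) := by
  classical
  set ν := Measure.map ξ μ with hν
  have hrot' : ∀ O : Matrix (Fin n) (Fin n) ℝ, Oᵀ * O = 1 → ν.map (fun x => O *ᵥ x) = ν := by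
    intro O hO
    refine Eq.trans ?_ (hrot O hO)
    rw [hν, Measure.map_map (by fun_prop) hmeas]
    rfl
  have hI : ∀ g : (Fin n → ℝ) → ℝ, Continuous g → ∫ ω, g (ξ ω) ∂μ = ∫ x, g x ∂ν := fun g hg =>
    (integral_map hmeas.aemeasurable hg.aestronglyMeasurable).symm
  have hmom' : Integrable (fun x : Fin n → ℝ => (∑ i, x i ^ 2) ^ k) ν := by
    rw [hν, integrable_map_measure (Continuous.aestronglyMeasurable (by fun_prop))
      hmeas.aemeasurable]
    exact hmom
  intro i
  rw [hI (fun x => ∏ a, x (i a)) (by fun_prop), hI (fun x => (∑ j, x j ^ 2) ^ k) (by fun_prop)]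
  set C := (∫ x, (∑ j, x j ^ 2) ^ k ∂ν) / (∏ j ∈ Finset.range k, ((n : ℝ) + 2 * (j : ℝ))) with hC
  rw [← sub_eq_zero]
  refine aux_tensor (fun i : Fin (2 * k) → Fin n => ∫ x, ∏ a, x (i a) ∂ν - C *
    ∑ f : {f : Equiv.Perm (Fin (2 * k)) // (∀ a, f (f a) = a) ∧ ∀ a, f a ≠ a},
            ∏ a, (if i a = i (f.1 a) then (1 : ℝ) else 0)) ?_ ?_ i
  · intro σ i
    rw [aux_symQ]
    congr 2
    funext x
    exact Equiv.prod_comp σ (fun a => x (i a))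
  · intro u
    let z : Fin n := ⟨0, hn⟩
    have h1 : ∑ i : Fin (2 * k) → Fin n, (∫ x, ∏ a, x (i a) ∂ν) * ∏ a, u (i a) =
        ∫ x, (u ⬝ᵥ x) ^ (2 * k) * (∑ l, x l ^ 2) ^ 0 ∂ν := by
      simp only [← integral_mul_const]
      rw [← integral_finsetSum _ (fun i _ => (aux_integrable3 ν k hmom' i).mul_const _)]
      congr 1
      funext x
      rw [pow_zero, mul_one, dotProduct, Fintype.sum_pow]
      refine Finset.sum_congr rfl fun i _ => ?_
      rw [← Finset.prod_mul_distrib]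
      exact Finset.prod_congr rfl fun a _ => mul_comm _ _
    have h2 := aux_norm ν k hrot' hmom' z k 0 rfl
    have h3 := aux_sumpair k hk u
    have hpos : (∏ j ∈ Finset.range k, ((n : ℝ) + 2 * (j : ℝ))) ≠ 0 := by
      refine Finset.prod_ne_zero_iff.mpr fun j _ => ?_
      have : (1 : ℝ) ≤ n := by exact_mod_cast hn
      positivity
    simp only [sub_mul, mul_assoc]
    rw [Finset.sum_sub_distrib, ← Finset.mul_sum, h1, h3, aux_const ν hrot' k 0 z u, hC]
    simp only [pow_zero, mul_one] at h2 ⊢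
    field_simp
    linear_combination (-(∑ l, u l ^ 2) ^ k) * h2
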